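/- arXiv:2307.07739 — 5 statements merged into one kernel-verified Lean document; each statement's English description precedes it below -/
import Mathlib

section
/- Let k > 0 and c > 0 be real numbers and define f : [0,1) → ℝ by f(x) = -(1-x)·ln(1-x)/(k·x + c). Then f attains a maximum over [0,1) at some point x_max, and every point at which f attains this maximum satisfies 0 < x_max < 1 - 1/e. -/
/-- For `k > 0` and `c > 0`, the function `f x = -(1-x) * log (1-x) / (k*x + c)`
attains a maximum over `[0,1)`, and every maximizer `x` satisfies `0 < x < 1 - 1/e`. -/
theorem f_max_location_k_pos (k c : ℝ) (hk : 0 < k) (hc : 0 < c) :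
    (∃ xmax ∈ Set.Ico (0:ℝ) 1, ∀ x ∈ Set.Ico (0:ℝ) 1,
        -(1 - x) * Real.log (1 - x) / (k * x + c) ≤
        -(1 - xmax) * Real.log (1 - xmax) / (k * xmax + c)) ∧
    ∀ xmax ∈ Set.Ico (0:ℝ) 1,
      (∀ x ∈ Set.Ico (0:ℝ) 1,
        -(1 - x) * Real.log (1 - x) / (k * x + c) ≤
        -(1 - xmax) * Real.log (1 - xmax) / (k * xmax + c)) →
      0 < xmax ∧ xmax < 1 - 1 / Real.exp 1 := by
  constructor
  · have hcont : ContinuousOn (fun x : ℝ => -(1 - x) * Real.log (1 - x) / (k * x + c))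
        (Set.Icc 0 1) := by
      refine ContinuousOn.div ?_ (by fun_prop) fun x hx => ?_
      · exact (Real.continuous_negMulLog.comp (continuous_const.sub continuous_id)).continuousOn
      · have := mul_nonneg hk.le hx.1
        positivity
    obtain ⟨p, hp, hmax⟩ := isCompact_Icc.exists_isMaxOn ⟨0, by simp⟩ hcont
    rcases hp.2.lt_or_eq with h1 | rfl
    · exact ⟨p, ⟨hp.1, h1⟩, fun x hx => hmax ⟨hx.1, hx.2.le⟩⟩
    · refine ⟨0, by simp, fun x hx => ?_⟩
      simpa using hmax (Set.Ico_subset_Icc_self hx)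
  · intro x hx hmax
    have hx0 : 0 < x := by
      refine hx.1.lt_of_ne ?_
      rintro rfl
      have hle := hmax (1 / 2) (by norm_num)
      have hlog : Real.log (1 - 1 / 2) < 0 := Real.log_neg (by norm_num) (by norm_num)
      have hpos : 0 < -(1 - 1 / 2) * Real.log (1 - 1 / 2) / (k * (1 / 2) + c) :=
        div_pos (mul_pos_of_neg_of_neg (by norm_num) hlog) (by positivity)
      have hzero : -(1 - (0 : ℝ)) * Real.log (1 - 0) / (k * 0 + c) = 0 := by simp
      linarith
    refine ⟨hx0, ?_⟩
    by_contra! hge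
    have hy : 0 < 1 - x := sub_pos.2 hx.2
    have hden : 0 < k * x + c := by positivity
    have hlog : Real.log (1 - x) ≤ -1 := by
      rw [Real.log_le_iff_le_exp hy, Real.exp_neg, ← one_div]
      linarith
    have hsub : HasDerivAt (fun t : ℝ => 1 - t) (-1) x := by
      simpa using (hasDerivAt_id x).const_sub 1
    have hlin : HasDerivAt (fun t : ℝ => k * t + c) k x := by
      simpa using ((hasDerivAt_id x).const_mul k).add_const c
    have hderiv := (hsub.neg.mul (hsub.log hy.ne')).div hlin hden.ne'
    have hloc : IsLocalMax (fun t : ℝ => -(1 - t) * Real.log (1 - t) / (k * t + c)) x := by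
      filter_upwards [Ioo_mem_nhds hx0 hx.2] with t ht
      exact hmax t (Set.Ioo_subset_Ico_self ht)
    have hzero := hloc.hasDerivAt_eq_zero hderiv
    rw [div_eq_zero_iff, or_iff_left (by positivity)] at hzero
    simp only [Pi.mul_apply, Pi.neg_apply] at hzero
    have hcancel : -(1 - x) * (-1 / (1 - x)) = 1 := by
      field_simp
    rw [hcancel] at hzero
    have h₁ : (Real.log (1 - x) + 1) * (k * x + c) ≤ 0 :=
      mul_nonpos_of_nonpos_of_nonneg (by linarith) hden.le
    have h₂ : (1 - x) * k * Real.log (1 - x) < 0 :=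
      mul_neg_of_pos_of_neg (by positivity) (by linarith)
    linarith
end

section
/- Let k < 0 and c > 0 be real numbers with k + c > 0, and define f : [0,1) → ℝ by f(x) = -(1-x)·ln(1-x)/(k·x + c). Then f attains a maximum over [0,1) at some point x_max, and every point at which f attains this maximum satisfies 1 - 1/e < x_max < 1. -/
/-- The function `t ↦ -t * log t` is at most `1 / e` on the positive reals. -/
theorem neg_mul_log_le_exp_inv {t : ℝ} (ht : 0 < t) : -t * Real.log t ≤ (Real.exp 1)⁻¹ := by
  have h := Real.one_sub_inv_le_log_of_pos (mul_pos ht (Real.exp_pos 1))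
  rw [Real.log_mul ht.ne' (Real.exp_pos 1).ne', Real.log_exp, mul_inv] at h
  have h2 : -Real.log t ≤ t⁻¹ * (Real.exp 1)⁻¹ := by linarith
  calc -t * Real.log t = t * -Real.log t := by ring
    _ ≤ t * (t⁻¹ * (Real.exp 1)⁻¹) := mul_le_mul_of_nonneg_left h2 ht.le
    _ = (Real.exp 1)⁻¹ := by rw [← mul_assoc, mul_inv_cancel₀ ht.ne', one_mul]

/-- For `k < 0`, `c > 0` with `k + c > 0`, the function
`f x = -(1-x) * log (1-x) / (k*x + c)` attains a maximum over `[0,1)`,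
and every maximizer `x` satisfies `1 - 1/e < x < 1`. -/
theorem f_max_location_k_neg (k c : ℝ) (hk : k < 0) (hc : 0 < c) (hkc : 0 < k + c) :
    (∃ xmax ∈ Set.Ico (0:ℝ) 1, ∀ x ∈ Set.Ico (0:ℝ) 1,
        -(1 - x) * Real.log (1 - x) / (k * x + c) ≤
        -(1 - xmax) * Real.log (1 - xmax) / (k * xmax + c)) ∧
    ∀ xmax ∈ Set.Ico (0:ℝ) 1,
      (∀ x ∈ Set.Ico (0:ℝ) 1,
        -(1 - x) * Real.log (1 - x) / (k * x + c) ≤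
        -(1 - xmax) * Real.log (1 - xmax) / (k * xmax + c)) →
      1 - 1 / Real.exp 1 < xmax ∧ xmax < 1 := by
  have hden : ∀ x ∈ Set.Icc (0 : ℝ) 1, 0 < k * x + c := fun x hx => by nlinarith [hx.1, hx.2]
  constructor
  · have hcont : ContinuousOn (fun x : ℝ => -(1 - x) * Real.log (1 - x) / (k * x + c))
        (Set.Icc 0 1) := by
      refine ContinuousOn.div ?_ (by fun_prop) fun x hx => (hden x hx).ne'
      exact (Real.continuous_negMulLog.comp (continuous_const.sub continuous_id)).continuousOn
    obtain ⟨m, hm, hmax⟩ := isCompact_Icc.exists_isMaxOn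
      (Set.nonempty_Icc.2 (zero_le_one (α := ℝ))) hcont
    rcases hm.2.lt_or_eq with h1 | rfl
    · exact ⟨m, ⟨hm.1, h1⟩, fun x hx => hmax (Set.Ico_subset_Icc_self hx)⟩
    · refine ⟨0, by simp, fun x hx => (hmax (Set.Ico_subset_Icc_self hx)).trans ?_⟩
      simp
  · intro m hm hmax
    refine ⟨?_, hm.2⟩
    rw [one_div]
    have he : 0 < (Real.exp 1)⁻¹ := inv_pos.2 (Real.exp_pos 1)
    have he1 : (Real.exp 1)⁻¹ < 1 := inv_lt_one_of_one_lt₀ (Real.one_lt_exp_iff.2 one_pos)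
    have hlog : Real.log (Real.exp 1)⁻¹ = -1 := by rw [Real.log_inv, Real.log_exp]
    by_contra! hle
    rcases hle.lt_or_eq with hlt | rfl
    · have h := hmax (1 - (Real.exp 1)⁻¹) ⟨by linarith, by linarith⟩
      rw [sub_sub_cancel, hlog] at h
      have hd := hden (1 - (Real.exp 1)⁻¹) ⟨by linarith, by linarith⟩
      have hdm := hden m (Set.Ico_subset_Icc_self hm)
      have h3 : -(1 - m) * Real.log (1 - m) / (k * m + c) ≤ (Real.exp 1)⁻¹ / (k * m + c) :=
        div_le_div_of_nonneg_right (neg_mul_log_le_exp_inv (by linarith [hm.2])) hdm.le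
      have h4 : (Real.exp 1)⁻¹ / (k * m + c) <
          (Real.exp 1)⁻¹ / (k * (1 - (Real.exp 1)⁻¹) + c) :=
        div_lt_div_of_pos_left he hd (by nlinarith)
      rw [neg_mul_neg, mul_one] at h
      linarith
    · have hd := hden _ (Set.Ico_subset_Icc_self hm)
      have hloc : IsLocalMax (fun x : ℝ => -(1 - x) * Real.log (1 - x) / (k * x + c))
          (1 - (Real.exp 1)⁻¹) := by
        filter_upwards [Ico_mem_nhds (show 0 < 1 - (Real.exp 1)⁻¹ by linarith) hm.2] with x hx
        exact hmax x hx
      have hsub : HasDerivAt (fun x : ℝ => 1 - x) (-1) (1 - (Real.exp 1)⁻¹) :=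
        (hasDerivAt_id' _).const_sub 1
      have hderiv := (hsub.neg.mul (hsub.log (by rw [sub_sub_cancel]; exact he.ne'))).div
        (((hasDerivAt_id' (1 - (Real.exp 1)⁻¹)).const_mul k).add_const c) hd.ne'
      have h0 := hloc.hasDerivAt_eq_zero hderiv
      rw [div_eq_zero_iff, or_iff_left (pow_pos hd 2).ne'] at h0
      simp only [Pi.neg_apply, Pi.mul_apply, sub_sub_cancel, hlog] at h0
      have h5 : -(Real.exp 1)⁻¹ * (-1 / (Real.exp 1)⁻¹) = 1 := by field_simp
      rw [h5] at h0
      nlinarith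
end

section
/- Define, for 0 < v < y < 1, F(y,v) = (1 + (y-v)/(1-y)² + v - (y·(1-v)/(1-y))·ln(1-v)) / (-y - ln(1-y) + (y³ - v·y²)/(1-y)² + (1 - v·y)/(1-y)). Then F(y,v) ≤ 1.2259 for all 0 < v < y < 1. -/
/-- An auxiliary function whose derivative factors, with a critical point at `1 + δ`. -/
noncomputable def reducedRatioGap (δ x : ℝ) : ℝ :=
  2 * δ - x + (1 + δ) * (Real.log x - Real.log δ) - (x / δ - 1) * Real.exp (-x)

lemma hasDerivAt_reducedRatioGap {δ x : ℝ} (hδ : 0 < δ) (hx : 0 < x) :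
    HasDerivAt (reducedRatioGap δ)
      ((x - (1 + δ)) * (x / δ - Real.exp x) * (Real.exp (-x) / x)) x := by
  have h1 := ((hasDerivAt_const x (2 * δ)).sub (hasDerivAt_id x)).add
    (((Real.hasDerivAt_log hx.ne').sub_const (Real.log δ)).const_mul (1 + δ))
  have h2 := (((hasDerivAt_id x).div_const δ).sub_const 1).mul (hasDerivAt_id x).neg.exp
  have h3 := h1.sub h2
  refine h3.congr_deriv ?_
  have he : Real.exp x * Real.exp (-x) = 1 := by rw [← Real.exp_add]; simp
  simp only [id, Pi.neg_apply]
  field_simp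
  linear_combination (δ * (x - 1 - δ)) * he

lemma exp_le_div_of_mem_uIcc {δ a b t : ℝ} (ha : Real.exp a ≤ a / δ)
    (hb : Real.exp b ≤ b / δ) (ht : t ∈ Set.uIcc a b) : Real.exp t ≤ t / δ := by
  rw [← segment_eq_uIcc] at ht
  obtain ⟨p, q, hp, hq, hpq, rfl⟩ := ht
  have h := convexOn_exp.2 (Set.mem_univ a) (Set.mem_univ b) hp hq hpq
  simp only [smul_eq_mul] at h ⊢
  calc Real.exp (p * a + q * b) ≤ p * Real.exp a + q * Real.exp b := h
    _ ≤ p * (a / δ) + q * (b / δ) := by gcongr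
    _ = (p * a + q * b) / δ := by ring

/-- `1 + δ` minimizes `reducedRatioGap δ` on the region where `exp x ≤ x / δ`. -/
lemma reducedRatioGap_ge {δ x : ℝ} (hδ : 0 < δ) (hx : 0 < x) (hxe : Real.exp x ≤ x / δ)
    (hce : Real.exp (1 + δ) ≤ (1 + δ) / δ) :
    reducedRatioGap δ (1 + δ) ≤ reducedRatioGap δ x := by
  rcases le_total x (1 + δ) with h | h
  · have hpos : ∀ t ∈ Set.Icc x (1 + δ), 0 < t := fun t ht => hx.trans_le ht.1
    refine antitoneOn_of_deriv_nonpos (convex_Icc x (1 + δ))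
      (fun t ht => (hasDerivAt_reducedRatioGap hδ (hpos t ht)).continuousAt.continuousWithinAt)
      (fun t ht => (hasDerivAt_reducedRatioGap hδ
        (hpos t (interior_subset ht))).differentiableAt.differentiableWithinAt)
      (fun t ht => ?_) (Set.left_mem_Icc.2 h) (Set.right_mem_Icc.2 h) h
    have ht' := interior_subset ht
    rw [(hasDerivAt_reducedRatioGap hδ (hpos t ht')).deriv]
    have he := exp_le_div_of_mem_uIcc hxe hce (Set.Icc_subset_uIcc ht')
    exact mul_nonpos_of_nonpos_of_nonneg
      (mul_nonpos_of_nonpos_of_nonneg (by linarith [ht'.2]) (by linarith))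
      (div_nonneg (Real.exp_pos _).le (hpos t ht').le)
  · have hpos : ∀ t ∈ Set.Icc (1 + δ) x, 0 < t := fun t ht => by linarith [ht.1]
    refine monotoneOn_of_deriv_nonneg (convex_Icc (1 + δ) x)
      (fun t ht => (hasDerivAt_reducedRatioGap hδ (hpos t ht)).continuousAt.continuousWithinAt)
      (fun t ht => (hasDerivAt_reducedRatioGap hδ
        (hpos t (interior_subset ht))).differentiableAt.differentiableWithinAt)
      (fun t ht => ?_) (Set.left_mem_Icc.2 h) (Set.right_mem_Icc.2 h) h
    have ht' := interior_subset ht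
    rw [(hasDerivAt_reducedRatioGap hδ (hpos t ht')).deriv]
    have he := exp_le_div_of_mem_uIcc hce hxe (Set.Icc_subset_uIcc ht')
    exact mul_nonneg (mul_nonneg (by linarith [ht'.1]) (by linarith))
      (div_nonneg (Real.exp_pos _).le (hpos t ht').le)

lemma le_exp_critical : (3.4072 : ℝ) ≤ Real.exp 1.2259 := by
  refine le_trans ?_ (Real.sum_le_exp_of_nonneg (by norm_num) 14)
  norm_num [Finset.sum_range_succ, Nat.factorial]

lemma le_log_critical : (1.6913 : ℝ) ≤ Real.log (1.2259 / 0.2259) := by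
  rw [Real.le_log_iff_exp_le (by norm_num)]
  have h := Real.exp_bound' (x := 0.84565) (by norm_num) (by norm_num) (n := 10) (by norm_num)
  have h2 : Real.exp 1.6913 = Real.exp 0.84565 ^ 2 := by
    rw [← Real.exp_nat_mul]; norm_num
  rw [h2]
  refine (pow_le_pow_left₀ (Real.exp_pos _).le h 2).trans ?_
  norm_num [Finset.sum_range_succ, Nat.factorial]

lemma reducedRatioGap_critical_nonneg : 0 ≤ reducedRatioGap 0.2259 (1 + 0.2259) := by
  have h1 := le_log_critical
  rw [Real.log_div (by norm_num) (by norm_num)] at h1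
  have h2 : Real.exp (-1.2259) ≤ 1 / 3.4072 := by
    rw [Real.exp_neg, ← one_div]
    exact one_div_le_one_div_of_le (by norm_num) le_exp_critical
  rw [show (1 + 0.2259 : ℝ) = 1.2259 by norm_num]
  unfold reducedRatioGap
  norm_num at h1 h2 ⊢
  linarith

lemma reducedRatioGap_nonneg {x : ℝ} (hx : 0 < x) (hxe : Real.exp x ≤ x / 0.2259) :
    0 ≤ reducedRatioGap 0.2259 x := by
  refine reducedRatioGap_critical_nonneg.trans
    (reducedRatioGap_ge (by norm_num) hx hxe ?_)
  rw [← Real.le_log_iff_exp_le (by norm_num)]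
  have := le_log_critical
  norm_num at this ⊢
  linarith

/-- The gap on the diagonal `v = y`, with `u = 1 - y`. -/
lemma diagonal_gap_nonneg {u : ℝ} (hu : 0 < u) (hu1 : u < 1) :
    0 ≤ 0.2259 - 1 + u - (0.2259 + u) * Real.log u := by
  have hlog2 := Real.log_two_gt_d9
  have tangent : ∀ n : ℕ, Real.log u ≤ 2 ^ n * u - 1 - n * Real.log 2 := fun n => by
    have h := Real.log_le_sub_one_of_pos (show 0 < 2 ^ n * u by positivity)
    rw [Real.log_mul (by positivity) hu.ne', Real.log_pow] at h
    linarith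
  have key : ∀ b : ℝ, Real.log u ≤ b →
      0 ≤ 0.2259 - 1 + u - (0.2259 + u) * b →
      0 ≤ 0.2259 - 1 + u - (0.2259 + u) * Real.log u := fun b hb h => by
    have : (0.2259 + u) * Real.log u ≤ (0.2259 + u) * b := by gcongr
    linarith
  rcases le_total u 0.055 with h1 | h1
  · have h := tangent 5
    norm_num at h
    exact key (32 * u - 4.46) (by linarith) (by nlinarith)
  rcases le_total u 0.17 with h2 | h2
  · have h := tangent 3
    norm_num at h
    exact key (8 * u - 3.07) (by linarith) (by nlinarith)
  rcases le_total u 0.45 with h3 | h3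
  · have h := tangent 2
    norm_num at h
    exact key (4 * u - 2.38) (by linarith) (by nlinarith)
  · have h := tangent 0
    norm_num at h
    exact key (u - 1) (by linarith) (by nlinarith)

/-- The cleared form of the bound, with `u = 1 - y` and `w = 1 - v`. -/
lemma cleared_gap_nonneg {u w : ℝ} (hu : 0 < u) (hu1 : u < 1) (huw : u < w) :
    0 ≤ u * (0.2259 * (2 * u - 1) - 1.2259 * (u * Real.log u)) +
      (1 - u) * w * (0.2259 - u + u * Real.log w) := by
  have hw : 0 < w := hu.trans huw
  rcases le_total 0 (0.2259 + u * Real.log u) with h | h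
  · have hlog : w * Real.log u + w - u ≤ w * Real.log w := by
      have h1 := Real.log_le_sub_one_of_pos (div_pos hu hw)
      rw [Real.log_div hu.ne' hw.ne'] at h1
      have h2 := mul_le_mul_of_nonneg_left h1 hw.le
      have h3 : w * (u / w - 1) = u - w := by field_simp
      linarith
    have hd := mul_nonneg (sq_nonneg u) (diagonal_gap_nonneg hu hu1)
    have hs := mul_nonneg (mul_nonneg (sub_nonneg.2 hu1.le) h) (sub_nonneg.2 huw.le)
    have hl := mul_le_mul_of_nonneg_left hlog (mul_nonneg (sub_nonneg.2 hu1.le) hu.le)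
    linarith
  · have hx : 0 < 0.2259 / u := by positivity
    have hgap := reducedRatioGap_nonneg hx (by
      rw [div_div_cancel_left' (by norm_num), ← Real.le_log_iff_exp_le (by positivity),
        Real.log_inv, div_le_iff₀ hu]
      linarith)
    have hlog : w * (1 - 0.2259 / u) - Real.exp (-(0.2259 / u)) ≤ w * Real.log w := by
      have h1 := Real.add_one_le_exp (-(0.2259 / u) - Real.log w)
      rw [Real.exp_sub, Real.exp_log hw, le_div_iff₀ hw] at h1
      linarith
    unfold reducedRatioGap at hgap
    rw [Real.log_div (by norm_num) hu.ne'] at hgap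
    have hg := mul_nonneg (sq_nonneg u) hgap
    have hl := mul_le_mul_of_nonneg_left hlog (mul_nonneg (sub_nonneg.2 hu1.le) hu.le)
    generalize Real.exp (-(0.2259 / u)) = e at *
    field_simp at hg hl
    norm_num at hg hl ⊢
    linarith


/-- The closed-form worst-case performance ratio
`F(y,v) = (1 + (y-v)/(1-y)² + v - (y·(1-v)/(1-y))·log(1-v)) /
          (-y - log(1-y) + (y³ - v·y²)/(1-y)² + (1 - v·y)/(1-y))`
satisfies `F(y,v) ≤ 1.2259` for all `0 < v < y < 1`. -/
theorem performance_ratio_bound (y v : ℝ) (hv : 0 < v) (hvy : v < y) (hy : y < 1) :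
    (1 + (y - v) / (1 - y) ^ 2 + v -
        (y * (1 - v) / (1 - y)) * Real.log (1 - v)) /
      (-y - Real.log (1 - y) + (y ^ 3 - v * y ^ 2) / (1 - y) ^ 2 +
        (1 - v * y) / (1 - y)) ≤ (1.2259 : ℝ) := by
  have hy0 : 0 < y := hv.trans hvy
  have hu : 0 < 1 - y := sub_pos.2 hy
  have hden : 0 < -y - Real.log (1 - y) + (y ^ 3 - v * y ^ 2) / (1 - y) ^ 2 +
      (1 - v * y) / (1 - y) := by
    have h1 := Real.log_le_sub_one_of_pos hu
    have h2 : 0 < (y ^ 3 - v * y ^ 2) / (1 - y) ^ 2 :=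
      div_pos (by nlinarith [mul_pos (sub_pos.2 hvy) (pow_pos hy0 2)]) (by positivity)
    have h3 : 0 < (1 - v * y) / (1 - y) := div_pos (by nlinarith) hu
    linarith
  rw [div_le_iff₀ hden, ← sub_nonneg]
  have h := cleared_gap_nonneg hu (by linarith) (show 1 - y < 1 - v by linarith)
  refine (div_nonneg h (sq_nonneg (1 - y))).trans_eq ?_
  field_simp
  ring
end

section
/- Let 0 < p1 < p2 be real numbers. The function h(l) = p1·l / (p1² + (p2/(p2-p1))·l·(p1 + l/2) + p2·(p2 + l + p1)), defined for l > 0, attains its maximum at l = √(2·(p2³ - p1³)/p2); that is, h(l) ≤ h(√(2·(p2³ - p1³)/p2)) for every l > 0. -/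
/-- For `0 < p1 < p2`, the function
`h(l) = p1·l / (p1² + (p2/(p2-p1))·l·(p1 + l/2) + p2·(p2 + l + p1))`
on `l > 0` attains its maximum at `l = √(2·(p2³ - p1³)/p2)`. -/
theorem adversary_optimal_length (p1 p2 : ℝ) (hp1 : 0 < p1) (hp12 : p1 < p2) :
    ∀ l : ℝ, 0 < l →
      p1 * l / (p1 ^ 2 + (p2 / (p2 - p1)) * l * (p1 + l / 2) + p2 * (p2 + l + p1)) ≤
      p1 * Real.sqrt (2 * (p2 ^ 3 - p1 ^ 3) / p2) /
        (p1 ^ 2 + (p2 / (p2 - p1)) * Real.sqrt (2 * (p2 ^ 3 - p1 ^ 3) / p2) *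
          (p1 + Real.sqrt (2 * (p2 ^ 3 - p1 ^ 3) / p2) / 2) +
          p2 * (p2 + Real.sqrt (2 * (p2 ^ 3 - p1 ^ 3) / p2) + p1)) := by
  intro l hl
  have hp2 : 0 < p2 := hp1.trans hp12
  have hd : 0 < p2 - p1 := sub_pos.mpr hp12
  have hc : 0 < p2 ^ 3 - p1 ^ 3 := sub_pos.mpr (pow_lt_pow_left₀ hp12 hp1.le (by norm_num))
  have hr : 0 < 2 * (p2 ^ 3 - p1 ^ 3) / p2 := by positivity
  have hs : 0 < Real.sqrt (2 * (p2 ^ 3 - p1 ^ 3) / p2) := Real.sqrt_pos.mpr hr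
  have hsq := Real.sq_sqrt hr.le
  generalize Real.sqrt (2 * (p2 ^ 3 - p1 ^ 3) / p2) = s at hs hsq ⊢
  have hk : 0 < p2 / (p2 - p1) := div_pos hp2 hd
  have hks : p2 / (p2 - p1) * s ^ 2 = 2 * (p1 ^ 2 + p1 * p2 + p2 ^ 2) := by
    rw [hsq]
    field_simp
    ring
  generalize p2 / (p2 - p1) = k at hk hks ⊢
  rw [div_le_div_iff₀ (by positivity) (by positivity)]
  have key : 0 ≤ p1 * (k / 2 * s * (s - l) ^ 2) := by positivity
  linear_combination key + p1 * (s - l) / 2 * hks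
end

section
/- Let 0 < p1 < p2 and l > 0 be real numbers. Then for every q with p2 - p1 ≤ q ≤ p2, (p1·l + p2·(q - (p2 - p1))) / ((p2/q)·l·(p1 + l/2) + p2² + p2·l + p2·p1 + p1²) ≥ (p1·l) / ((p2/(p2-p1))·l·(p1 + l/2) + p2² + p2·l + p2·p1 + p1²). -/
/-- For `0 < p1 < p2`, `l > 0` and every `q` with `p2 - p1 ≤ q ≤ p2`:
`(p1·l + p2·(q - (p2 - p1))) / ((p2/q)·l·(p1 + l/2) + p2² + p2·l + p2·p1 + p1²)
  ≥ p1·l / ((p2/(p2-p1))·l·(p1 + l/2) + p2² + p2·l + p2·p1 + p1²)`. -/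
theorem remaining_time_monotone (p1 p2 l q : ℝ)
    (hp1 : 0 < p1) (hp12 : p1 < p2) (hl : 0 < l)
    (hq1 : p2 - p1 ≤ q) (hq2 : q ≤ p2) :
    p1 * l / ((p2 / (p2 - p1)) * l * (p1 + l / 2) + p2 ^ 2 + p2 * l + p2 * p1 + p1 ^ 2) ≤
    (p1 * l + p2 * (q - (p2 - p1))) /
      ((p2 / q) * l * (p1 + l / 2) + p2 ^ 2 + p2 * l + p2 * p1 + p1 ^ 2) := by
  have hd : 0 < p2 - p1 := sub_pos.2 hp12
  have hp2 : 0 < p2 := hp1.trans hp12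
  have hq : 0 < q := hd.trans_le hq1
  have hnum : 0 ≤ p2 * (q - (p2 - p1)) := mul_nonneg hp2.le (sub_nonneg.2 hq1)
  apply div_le_div₀
  · positivity
  · linarith
  · positivity
  · gcongr
end
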